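/- (q-Chu–Vandermonde sum) Let n be a nonnegative integer and let q, a, c be nonzero complex numbers with (q;q)_n ≠ 0 and (c;q)_n ≠ 0. Then ∑_{j=0}^{n} ((a;q)_j (q^{-n};q)_j / ((q;q)_j (c;q)_j)) · q^j = a^n · (c/a;q)_n / (c;q)_n. -/

import Mathlib

/-- The $q$-shifted factorial $(a;q)_m = \prod_{k=0}^{m-1}(1 - a q^k)$. -/
noncomputable def qPoch (q a : ℂ) (m : ℕ) : ℂ := ∏ k ∈ Finset.range m, (1 - a * q ^ k)

theorem qPoch_zero (q a : ℂ) : qPoch q a 0 = 1 := by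
  simp [qPoch]

theorem qPoch_succ (q a : ℂ) (m : ℕ) : qPoch q a (m + 1) = qPoch q a m * (1 - a * q ^ m) :=
  Finset.prod_range_succ _ _

theorem qPoch_succ_left (q a : ℂ) (m : ℕ) :
    qPoch q a (m + 1) = (1 - a) * qPoch q (a * q) m := by
  rw [qPoch, qPoch, Finset.prod_range_succ', mul_comm, pow_zero, mul_one]
  congr 1
  exact Finset.prod_congr rfl fun k _ => by ring

theorem qPoch_ne_zero_of_le {q a : ℂ} {m n : ℕ} (hmn : m ≤ n) (h : qPoch q a n ≠ 0) :
    qPoch q a m ≠ 0 := by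
  rw [qPoch, Finset.prod_ne_zero_iff] at h ⊢
  exact fun k hk => h k (Finset.mem_range.2 ((Finset.mem_range.1 hk).trans_le hmn))

theorem qPoch_zpow_neg_succ {q : ℂ} (hq : q ≠ 0) (n : ℕ) :
    qPoch q (q ^ (-(n : ℤ))) (n + 1) = 0 := by
  rw [qPoch_succ, zpow_neg, zpow_natCast, inv_mul_cancel₀ (pow_ne_zero n hq), sub_self, mul_zero]

/-- Contiguity relation for the summands of the `₂φ₁` series with argument `q`. -/
theorem qPoch_term_contiguous (q a c x : ℂ) (j : ℕ)
    (hqj : qPoch q q (j + 1) ≠ 0) (hcj : qPoch q c (j + 1) ≠ 0) :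
    qPoch q a (j + 1) * qPoch q x (j + 1) / (qPoch q q (j + 1) * qPoch q c (j + 1)) * q ^ (j + 1)
    = qPoch q a (j + 1) * qPoch q (x * q) (j + 1) / (qPoch q q (j + 1) * qPoch q c (j + 1))
        * q ^ (j + 1)
      - x * q * ((1 - a) / (1 - c)) *
        (qPoch q (a * q) j * qPoch q (x * q) j / (qPoch q q j * qPoch q (c * q) j) * q ^ j) := by
  rw [qPoch_succ_left q c] at hcj ⊢
  rw [qPoch_succ q q] at hqj ⊢
  rw [qPoch_succ_left q a, qPoch_succ_left q x, qPoch_succ q (x * q)]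
  obtain ⟨h1, h2⟩ := mul_ne_zero_iff.1 hcj
  obtain ⟨h3, h4⟩ := mul_ne_zero_iff.1 hqj
  field_simp
  ring

/-- $q$-Chu–Vandermonde sum. -/
theorem q_chu_vandermonde (n : ℕ) (q a c : ℂ) (hq : q ≠ 0) (ha : a ≠ 0) (hc : c ≠ 0)
    (hqq : qPoch q q n ≠ 0) (hcn : qPoch q c n ≠ 0) :
    ∑ j ∈ Finset.range (n + 1),
      qPoch q a j * qPoch q (q ^ (-(n : ℤ))) j / (qPoch q q j * qPoch q c j) * q ^ j
    = a ^ n * qPoch q (c / a) n / qPoch q c n := by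
  induction n generalizing a c with
  | zero => simp [qPoch_zero]
  | succ n ih =>
    have hx : q ^ (-((n + 1 : ℕ) : ℤ)) * q = q ^ (-(n : ℤ)) := by
      rw [← zpow_add_one₀ hq]
      congr 1
      push_cast
      ring
    have hqn := qPoch_ne_zero_of_le n.le_succ hqq
    have hcn' := qPoch_ne_zero_of_le n.le_succ hcn
    have hcn_left := hcn
    rw [qPoch_succ_left] at hcn_left
    obtain ⟨h1, h2⟩ := mul_ne_zero_iff.1 hcn_left
    have ih1 := ih a c ha hc hqn hcn'
    have ih2 := ih (a * q) (c * q) (mul_ne_zero ha hq) (mul_ne_zero hc hq) hqn h2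
    rw [mul_div_mul_right _ _ hq] at ih2
    have hext : ∑ j ∈ Finset.range (n + 1 + 1),
        qPoch q a j * qPoch q (q ^ (-(n : ℤ))) j / (qPoch q q j * qPoch q c j) * q ^ j
        = a ^ n * qPoch q (c / a) n / qPoch q c n := by
      rw [Finset.sum_range_succ, ih1, qPoch_zpow_neg_succ hq]
      simp
    rw [Finset.sum_range_succ'] at hext ⊢
    have hterm : ∀ j ∈ Finset.range (n + 1), _ := fun j hj =>
      qPoch_term_contiguous q a c (q ^ (-((n + 1 : ℕ) : ℤ))) j
        (qPoch_ne_zero_of_le (Finset.mem_range.1 hj) hqq)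
        (qPoch_ne_zero_of_le (Finset.mem_range.1 hj) hcn)
    rw [Finset.sum_congr rfl hterm, hx, Finset.sum_sub_distrib, ← Finset.mul_sum, ih2]
    simp only [qPoch_zero] at hext ⊢
    rw [sub_add_eq_add_sub, hext, zpow_neg, zpow_natCast]
    have hcc := (qPoch_succ q c n).symm.trans (qPoch_succ_left q c n)
    rw [qPoch_succ] at hcn
    have h3 := (mul_ne_zero_iff.1 hcn).2
    have hfrac : (1 - a) / (1 - c) / qPoch q (c * q) n
        = (1 - a) / (qPoch q c n * (1 - c * q ^ n)) := by
      rw [div_div, hcc]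
    calc _ = a ^ n * qPoch q (c / a) n / qPoch q c n
          - a ^ n * qPoch q (c / a) n * ((1 - a) / (1 - c) / qPoch q (c * q) n) := by
          rw [mul_pow]
          field_simp
      _ = _ := by
          rw [hfrac, qPoch_succ q c, qPoch_succ q (c / a)]
          field_simp
          ring
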